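/- Let n ≥ 1 and let a be an integer with 0 < a < 2n, a² ≡ 1 (mod 2n), and suppose gcd(a+1, 2n) does not divide n. Then the Hirzebruch–Jung continued fraction expansion 2n/a = [b₁, …, b_ℓ] has an odd number of entries, ℓ = 2m−1, and the middle entry b_m is even. -/

import Mathlib

/-- The solution `c` of the recursion `c (i + 2) = b (i + 1) * c (i + 1) - c i` with initial values
`c 0 = x` and `c 1 = y`. -/
def hjContinuant (b : ℕ → ℤ) (x y : ℤ) : ℕ → ℤ
  | 0 => x
  | 1 => y
  | i + 2 => b (i + 1) * hjContinuant b x y (i + 1) - hjContinuant b x y i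

theorem hjContinuant_add_two (b : ℕ → ℤ) (x y : ℤ) (i : ℕ) :
    hjContinuant b x y (i + 2) =
      b (i + 1) * hjContinuant b x y (i + 1) - hjContinuant b x y i := by
  rw [hjContinuant]

theorem hjContinuant_det (b : ℕ → ℤ) (i : ℕ) :
    hjContinuant b 0 1 i * hjContinuant b (-1) 0 (i + 1) -
      hjContinuant b 0 1 (i + 1) * hjContinuant b (-1) 0 i = 1 := by
  induction i with
  | zero => simp [hjContinuant]
  | succ i ih =>
    rw [hjContinuant_add_two, hjContinuant_add_two]
    linear_combination ih

theorem hjContinuant_nonneg_and_lt_succ {b : ℕ → ℤ} {l : ℕ} (hb : ∀ i, 1 ≤ i → i ≤ l → 2 ≤ b i)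
    (i : ℕ) (hi : i ≤ l) :
    0 ≤ hjContinuant b 0 1 i ∧ hjContinuant b 0 1 i < hjContinuant b 0 1 (i + 1) := by
  induction i with
  | zero => simp [hjContinuant]
  | succ i ih =>
    obtain ⟨h0, h1⟩ := ih (by omega)
    have h2 := hb (i + 1) (by omega) hi
    rw [hjContinuant_add_two]
    refine ⟨by omega, ?_⟩
    nlinarith

theorem eq_hjContinuant {l : ℕ} {b r : ℕ → ℤ}
    (hrec : ∀ i, 1 ≤ i → i ≤ l → r (i + 1) = b i * r i - r (i - 1)) (i : ℕ) (hi : i ≤ l) :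
    r i = r 1 * hjContinuant b 0 1 i - r 0 * hjContinuant b (-1) 0 i ∧
    r (i + 1) = r 1 * hjContinuant b 0 1 (i + 1) - r 0 * hjContinuant b (-1) 0 (i + 1) := by
  induction i with
  | zero => simp [hjContinuant]
  | succ i ih =>
    obtain ⟨h0, h1⟩ := ih (by omega)
    refine ⟨h1, ?_⟩
    rw [hrec (i + 1) (by omega) hi, hjContinuant_add_two, hjContinuant_add_two,
      Nat.add_sub_cancel]
    linear_combination b (i + 1) * h1 - h0

theorem Int.eq_of_dvd_sub_of_lt {x y m : ℤ} (hx : 0 ≤ x) (hxm : x < m) (hy : 0 ≤ y) (hym : y < m)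
    (h : m ∣ x - y) : x = y := by
  have := Int.eq_zero_of_abs_lt_dvd h (by rw [abs_lt]; constructor <;> linarith)
  linarith

/-- A Hirzebruch–Jung expansion of `N / a` with `a ^ 2 ≡ 1 (mod N)` is palindromic. -/
theorem eq_hjContinuant_reverse {l : ℕ} {b r : ℕ → ℤ} (hl : 1 ≤ l)
    (hsq : r 0 ∣ r 1 ^ 2 - 1) (h10 : r 1 < r 0)
    (hrec : ∀ i, 1 ≤ i → i ≤ l → r (i + 1) = b i * r i - r (i - 1))
    (hpos : ∀ i, 1 ≤ i → i ≤ l → 0 < r i)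
    (hnonneg : ∀ i, 1 ≤ i → i ≤ l → 0 ≤ r (i + 1))
    (hlt : ∀ i, 1 ≤ i → i ≤ l → r (i + 1) < r i)
    (hend : r (l + 1) = 0) (i j : ℕ) (hij : i + j = l + 1) :
    r i = hjContinuant b 0 1 j := by
  have hlt' : ∀ i, i ≤ l → r (i + 1) < r i := by
    intro i hi
    rcases Nat.eq_zero_or_pos i with rfl | h
    · exact h10
    · exact hlt i h hi
  have hb : ∀ i, 1 ≤ i → i ≤ l → 2 ≤ b i := by
    intro i h1 hi
    have e := hrec i h1 hi
    have p := hpos i h1 hi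
    have q := hnonneg i h1 hi
    have t := hlt' (i - 1) (by omega)
    rw [Nat.sub_add_cancel h1] at t
    by_contra! hc
    nlinarith
  have hmono := hjContinuant_nonneg_and_lt_succ hb
  obtain ⟨e0, e1⟩ := eq_hjContinuant hrec l le_rfl
  have hdet := hjContinuant_det b l
  have hpl := hpos l hl le_rfl
  obtain ⟨k, hk⟩ := hsq
  obtain ⟨hsl, hsl'⟩ := hmono l le_rfl
  set s := hjContinuant b 0 1
  set u := hjContinuant b (-1) 0
  have hN : r 0 = r l * s (l + 1) := by
    linear_combination - r 0 * hdet - s (l + 1) * e0 + s l * e1 - s l * hend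
  have ha : r 1 = r l * u (l + 1) := by
    linear_combination - r 1 * hdet - u (l + 1) * e0 + u l * e1 - u l * hend
  have hone : r l = 1 := by
    have hd : r l ∣ 1 := ⟨r 1 * u (l + 1) - s (l + 1) * k, by
      linear_combination -hk + r 1 * ha - k * hN⟩
    exact Int.eq_one_of_dvd_one hpl.le hd
  have hs0 : s (l + 1) = r 0 := by rw [hN, hone, one_mul]
  have hs1 : r 1 = s l := by
    refine Int.eq_of_dvd_sub_of_lt (hpos 1 le_rfl hl).le h10 hsl (by rw [← hs0]; exact hsl')
      ⟨k * s l - r 1 * u l, ?_⟩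
    linear_combination s l * hk + r 1 * e0 - r 1 * hone
  have key : ∀ i, i ≤ l → r i = s (l + 1 - i) ∧ r (i + 1) = s (l - i) := by
    intro i
    induction i with
    | zero => exact fun _ => ⟨by simpa using hs0.symm, by simpa using hs1⟩
    | succ i ih =>
      intro hi
      obtain ⟨h0, h1⟩ := ih (by omega)
      obtain ⟨j, rfl⟩ : ∃ j, l = i + 1 + j := ⟨l - (i + 1), by omega⟩
      have a0 : i + 1 + j + 1 - i = j + 2 := by omega
      have a1 : i + 1 + j - i = j + 1 := by omega
      have a2 : i + 1 + j + 1 - (i + 1) = j + 1 := by omega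
      have a3 : i + 1 + j - (i + 1) = j := by omega
      rw [a0] at h0
      rw [a1] at h1
      rw [a2, a3]
      refine ⟨h1, ?_⟩
      obtain ⟨m0, m1⟩ := hmono j (by omega)
      have e := hrec (i + 1) (by omega) hi
      rw [Nat.add_sub_cancel] at e
      have e' : s (j + 2) = b (j + 1) * s (j + 1) - s j := hjContinuant_add_two b 0 1 j
      refine Int.eq_of_dvd_sub_of_lt (hnonneg _ (by omega) hi) (hlt _ (by omega) hi) m0
        (by rw [h1]; exact m1) ⟨b (i + 1) - b (j + 1), ?_⟩
      linear_combination e - h0 - e' + b (j + 1) * h1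
  rcases Nat.lt_or_ge l i with h | h
  · obtain ⟨rfl, rfl⟩ : i = l + 1 ∧ j = 0 := by omega
    exact hend
  · rw [(key i h).1]
    congr 1
    omega

theorem gcd_dvd_of_odd_cofactor {n a : ℕ} {p d e : ℤ} (hN : (2 * n : ℤ) = p * d)
    (ha : (a : ℤ) = p * e) (hd : Even d) (he : Odd e) : Nat.gcd a (2 * n) ∣ n := by
  obtain ⟨c, rfl⟩ := hd
  have hn : (n : ℤ) = p * c := by linarith
  have hcop : IsCoprime e 2 := by
    obtain ⟨t, rfl⟩ := he
    exact ⟨1, -t, by ring⟩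
  obtain ⟨x, y, hxy⟩ := hcop
  rw [← Int.natCast_dvd_natCast]
  have h1 : ((Nat.gcd a (2 * n) : ℕ) : ℤ) ∣ a := Int.natCast_dvd_natCast.2 (Nat.gcd_dvd_left _ _)
  have h2 : ((Nat.gcd a (2 * n) : ℕ) : ℤ) ∣ 2 * n := by
    exact_mod_cast Nat.gcd_dvd_right a (2 * n)
  have : (n : ℤ) = a * (x * c) + 2 * n * y := by
    linear_combination (-n : ℤ) * hxy + x * e * hn - x * c * ha
  rw [this]
  exact dvd_add (h1.mul_right _) (h2.mul_right _)


/-- If `a² ≡ 1 (mod 2n)` and `gcd(a+1, 2n)` does not divide `n`, then the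
Hirzebruch–Jung continued fraction expansion `2n/a = [b₁, …, b_ℓ]` has an odd number
of entries `ℓ = 2m − 1`, and the middle entry `b m` is even. The expansion is encoded
by the remainder sequence `r` as in the HJ recursion. -/
theorem stmt_6 (n : ℕ) (hn : 1 ≤ n) (a : ℕ) (ha0 : 0 < a) (ha : a < 2 * n)
    (hsq : a ^ 2 ≡ 1 [MOD 2 * n])
    (hsmall : ¬ (Nat.gcd (a + 1) (2 * n) ∣ n))
    (ℓ : ℕ) (hℓ : 1 ≤ ℓ) (b : ℕ → ℤ) (r : ℕ → ℤ)
    (hr0 : r 0 = 2 * n) (hr1 : r 1 = a)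
    (hrec : ∀ i, 1 ≤ i → i ≤ ℓ → r (i + 1) = b i * r i - r (i - 1))
    (hpos : ∀ i, 1 ≤ i → i ≤ ℓ → 0 < r i)
    (hnonneg : ∀ i, 1 ≤ i → i ≤ ℓ → 0 ≤ r (i + 1))
    (hlt : ∀ i, 1 ≤ i → i ≤ ℓ → r (i + 1) < r i)
    (hend : r (ℓ + 1) = 0) :
    Odd ℓ ∧ ∃ m : ℕ, ℓ + 1 = 2 * m ∧ Even (b m) := by
  have hN : (2 * n : ℤ) ∣ r 1 ^ 2 - 1 := by
    rw [hr1]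
    have := (Nat.modEq_iff_dvd.1 hsq.symm)
    push_cast at this
    exact this
  have h10 : r 1 < r 0 := by rw [hr0, hr1]; exact_mod_cast ha
  have hrev := eq_hjContinuant_reverse hℓ (by rwa [hr0]) h10 hrec hpos hnonneg hlt hend
  have hform := eq_hjContinuant hrec
  rw [hr0, hr1] at hform
  rcases Nat.even_or_odd' ℓ with ⟨m, rfl | rfl⟩
  · exfalso
    apply hsmall
    obtain ⟨f0, f1⟩ := hform m (by omega)
    have g0 := hrev m (m + 1) (by omega)
    have g1 := hrev (m + 1) m (by omega)
    have hdet := hjContinuant_det b m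
    set s := hjContinuant b 0 1
    set u := hjContinuant b (-1) 0
    rw [g0] at f0
    rw [g1] at f1
    have hNf : (2 * n : ℤ) = (s (m + 1) + s m) * (s (m + 1) - s m) := by
      linear_combination (-2 * n : ℤ) * hdet - s (m + 1) * f0 + s m * f1
    have hd : s (m + 1) - s m ≠ 0 := by
      intro h
      rw [h, mul_zero] at hNf
      omega
    have haf : (a + 1 : ℤ) = (s (m + 1) + s m) * (u (m + 1) - u m) := by
      apply mul_right_cancel₀ hd
      linear_combination f0 - f1 + (u (m + 1) - u m) * hNf
    have hev : Even (s (m + 1) - s m) := by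
      have : Even ((s (m + 1) + s m) * (s (m + 1) - s m)) := hNf ▸ even_two_mul _
      grind
    refine gcd_dvd_of_odd_cofactor hNf (by exact_mod_cast haf) hev ?_
    have : Odd (s m * u (m + 1) - s (m + 1) * u m) := hdet ▸ odd_one
    simp only [Int.even_sub, Int.even_mul, ← Int.not_even_iff_odd] at this hev ⊢
    tauto
  · refine ⟨⟨m, rfl⟩, m + 1, by omega, ?_⟩
    by_contra hb
    apply hsmall
    obtain ⟨f0, f1⟩ := hform m (by omega)
    obtain ⟨-, f2⟩ := hform (m + 1) (by omega)
    have g0 := hrev m (m + 2) (by omega)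
    have g1 := hrev (m + 1) (m + 1) (by omega)
    have g2 := hrev (m + 2) m (by omega)
    have hdet := hjContinuant_det b m
    have hs := hjContinuant_add_two b 0 1 m
    have hu := hjContinuant_add_two b (-1) 0 m
    set s := hjContinuant b 0 1
    set u := hjContinuant b (-1) 0
    rw [g0] at f0
    rw [g1] at f1
    rw [g2] at f2
    have hNf : (2 * n : ℤ) = s (m + 1) * (s (m + 2) - s m) := by
      linear_combination (-2 * n : ℤ) * hdet - s (m + 1) * f0 + s m * f1
    have hd : s (m + 2) - s m ≠ 0 := by
      intro h
      rw [h, mul_zero] at hNf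
      omega
    have haf : (a + 1 : ℤ) = s (m + 1) * (u (m + 2) - u m) := by
      apply mul_right_cancel₀ hd
      linear_combination f0 - f2 + (u (m + 2) - u m) * hNf
    have hev : Even (s (m + 1) * (s (m + 2) - s m)) := hNf ▸ even_two_mul _
    have hodd : Odd (s m * u (m + 1) - s (m + 1) * u m) := hdet ▸ odd_one
    rw [hs] at hev
    have hpar : Even (s (m + 2) - s m) ∧ Odd (u (m + 2) - u m) := by
      rw [hs, hu]
      simp only [Int.even_sub, Int.even_mul, ← Int.not_even_iff_odd] at hev hodd ⊢
      tauto
    exact gcd_dvd_of_odd_cofactor hNf (by exact_mod_cast haf) hpar.1 hpar.2
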